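/- Let S and T be finite sets of positive integers and let x be a positive integer such that T_{≥x} ⪯ S_{>x}. Then T ◁ S is the disjoint union (T_{<x} ◁ S_{≤x}) ⊔ (T_{≥x} ◁ S_{>x}). -/

import Mathlib

/-- The `◁` operator: `tri T S = T ◁ S`.  Iterate through the elements of `S` from
largest to smallest; the current element `s` picks the largest element of `T` that is
less than `s` and has not yet been picked (if such an element exists), and the picked
elements form `T ◁ S`. -/
def tri (T S : Finset ℕ) : Finset ℕ :=
  if hS : S.Nonempty then
    if hT : (T.filter (fun t => t < S.max' hS)).Nonempty then
      insert ((T.filter (fun t => t < S.max' hS)).max' hT)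
        (tri (T.filter (fun t => t < (T.filter (fun t => t < S.max' hS)).max' hT))
          (S.erase (S.max' hS)))
    else ∅
  else ∅
termination_by S.card
decreasing_by
  exact Finset.card_erase_lt_of_mem (S.max'_mem hS)

/-- `nth S i` is the `i`-th smallest element of `S` (1-based), i.e. `S(i)`. -/
def nth (S : Finset ℕ) (i : ℕ) : ℕ :=
  (S.sort (· ≤ ·)).getD (i - 1) 0

/-- `Dom T S` means `T ⪯ S`, i.e. `S` dominates `T`:
`|T| ≥ |S|` and `T(i) < S(i)` for all `1 ≤ i ≤ |S|`. -/
def Dom (T S : Finset ℕ) : Prop :=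
  S.card ≤ T.card ∧ ∀ i, 1 ≤ i → i ≤ S.card → nth T i < nth S i

theorem tri_empty_right (T : Finset ℕ) : tri T ∅ = ∅ := by
  rw [tri]; simp

theorem tri_step (T S : Finset ℕ) (m t : ℕ) (hm : m ∈ S) (hmax : ∀ s ∈ S, s ≤ m)
    (ht : t ∈ T) (htm : t < m) (htmax : ∀ u ∈ T, u < m → u ≤ t) :
    tri T S = insert t (tri (T.filter (fun u => u < t)) (S.erase m)) := by
  have hS : S.Nonempty := ⟨m, hm⟩
  have e1 : S.max' hS = m := le_antisymm (S.max'_le hS m hmax) (S.le_max' m hm)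
  subst e1
  have hT : (T.filter (fun t => t < S.max' hS)).Nonempty := ⟨t, by simp [ht, htm]⟩
  have e2 : (T.filter (fun t => t < S.max' hS)).max' hT = t := by
    apply le_antisymm
    · apply Finset.max'_le
      intro y hy
      rw [Finset.mem_filter] at hy
      exact htmax y hy.1 hy.2
    · apply Finset.le_max'
      simp [ht, htm]
  rw [tri, dif_pos hS, dif_pos hT, e2]

theorem tri_none (T S : Finset ℕ) (m : ℕ) (hm : m ∈ S) (hmax : ∀ s ∈ S, s ≤ m)
    (h : ∀ u ∈ T, ¬ u < m) : tri T S = ∅ := by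
  have hS : S.Nonempty := ⟨m, hm⟩
  have e1 : S.max' hS = m := le_antisymm (S.max'_le hS m hmax) (S.le_max' m hm)
  subst e1
  rw [tri, dif_pos hS, dif_neg]
  rintro ⟨u, hu⟩
  rw [Finset.mem_filter] at hu
  exact h u hu.1 hu.2

theorem exists_greatest (A : Finset ℕ) (h : A.Nonempty) : ∃ m ∈ A, ∀ s ∈ A, s ≤ m :=
  ⟨A.max' h, A.max'_mem h, fun s hs => A.le_max' s hs⟩

theorem tri_cases (T S : Finset ℕ) :
    (S = ∅) ∨ (∃ m ∈ S, (∀ s ∈ S, s ≤ m) ∧ ((∀ u ∈ T, ¬ u < m) ∨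
      ∃ t ∈ T, t < m ∧ ∀ u ∈ T, u < m → u ≤ t)) := by
  rcases S.eq_empty_or_nonempty with h | h
  · exact Or.inl h
  · obtain ⟨m, hm, hmax⟩ := exists_greatest S h
    refine Or.inr ⟨m, hm, hmax, ?_⟩
    by_cases hT : (T.filter (fun u => u < m)).Nonempty
    · obtain ⟨t, ht, h2⟩ := exists_greatest _ hT
      simp only [Finset.mem_filter] at ht h2
      exact Or.inr ⟨t, ht.1, ht.2, fun u hu hum => h2 u ⟨hu, hum⟩⟩
    · left
      intro u hu hum
      exact hT ⟨u, by simp [hu, hum]⟩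

theorem tri_subset : ∀ (n : ℕ) (T S : Finset ℕ), S.card = n → tri T S ⊆ T := by
  intro n
  induction n with
  | zero =>
    intro T S h
    rw [Finset.card_eq_zero] at h
    simp [h, tri_empty_right]
  | succ n ih =>
    intro T S h
    rcases tri_cases T S with rfl | ⟨m, hm, hmax, h1 | ⟨t, ht, htm, htmax⟩⟩
    · simp at h
    · simp [tri_none T S m hm hmax h1]
    · rw [tri_step T S m t hm hmax ht htm htmax]
      have := ih (T.filter (fun u => u < t)) (S.erase m)
        (by rw [Finset.card_erase_of_mem hm]; omega)
      exact Finset.insert_subset ht (this.trans (Finset.filter_subset _ _))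

theorem tri_low (T S : Finset ℕ) (x : ℕ) (h : ∀ s ∈ S, s ≤ x) :
    tri T S = tri (T.filter (fun t => t < x)) S := by
  rcases tri_cases T S with rfl | ⟨m, hm, hmax, h1 | ⟨t, ht, htm, htmax⟩⟩
  · simp [tri_empty_right]
  · rw [tri_none T S m hm hmax h1, tri_none _ S m hm hmax]
    intro u hu
    exact h1 u (Finset.mem_filter.1 hu).1
  · have := h m hm
    rw [tri_step T S m t hm hmax ht htm htmax,
      tri_step (T.filter (fun t => t < x)) S m t hm hmax
        (Finset.mem_filter.2 ⟨ht, by omega⟩) htm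
        (fun u hu hum => htmax u (Finset.mem_filter.1 hu).1 hum)]
    congr 2
    ext u
    simp only [Finset.mem_filter]
    constructor
    · rintro ⟨a, b⟩; exact ⟨⟨a, by omega⟩, b⟩
    · rintro ⟨⟨a, _⟩, b⟩; exact ⟨a, b⟩

theorem dom_count (T S : Finset ℕ) (h : Dom T S) (s : ℕ) (hs : s ∈ S) :
    (S.filter (fun u => u ≤ s)).card ≤ (T.filter (fun t => t < s)).card := by
  obtain ⟨hc, hd⟩ := h
  have hs' : s ∈ S.sort (· ≤ ·) := (Finset.mem_sort _).2 hs
  obtain ⟨j, hj, rfl⟩ := List.getElem_of_mem hs'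
  have hjS : j < S.card := by simpa using hj
  have hjT : j < (T.sort (· ≤ ·)).length := by simp; omega
  have key := hd (j+1) (by omega) (by omega)
  simp only [nth, Nat.add_sub_cancel] at key
  rw [List.getD_eq_getElem _ _ hj, List.getD_eq_getElem _ _ hjT] at key
  have sS : (S.sort (· ≤ ·)).SortedLT := Finset.sortedLT_sort S
  have sT : (T.sort (· ≤ ·)).SortedLT := Finset.sortedLT_sort T
  have h1 : (S.filter (fun u => u ≤ (S.sort (· ≤ ·))[j])).card ≤ j + 1 := by
    calc _ ≤ ((Finset.range (j+1)).image (fun k => (S.sort (· ≤ ·)).getD k 0)).card := by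
          apply Finset.card_le_card
          intro u hu
          rw [Finset.mem_filter] at hu
          obtain ⟨k, hk, rfl⟩ := List.getElem_of_mem ((Finset.mem_sort (· ≤ ·)).2 hu.1)
          rw [Finset.mem_image]
          refine ⟨k, ?_, List.getD_eq_getElem _ _ hk⟩
          rw [Finset.mem_range]
          by_contra hcon
          have := sS.getElem_lt_getElem_of_lt (i := j) (j := k) (hi := hj) (hj := hk) (by omega)
          omega
      _ ≤ (Finset.range (j+1)).card := Finset.card_image_le
      _ = j + 1 := Finset.card_range _
  have h2 : j + 1 ≤ (T.filter (fun u => u < (S.sort (· ≤ ·))[j])).card := by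
    calc j + 1 = ((T.sort (· ≤ ·)).take (j+1)).toFinset.card := by
          rw [List.toFinset_card_of_nodup ((Finset.sort_nodup T _).sublist (List.take_sublist _ _)),
            List.length_take]
          omega
      _ ≤ _ := by
          apply Finset.card_le_card
          intro u hu
          rw [List.mem_toFinset] at hu
          have hu2 := List.mem_of_mem_take hu
          rw [Finset.mem_sort] at hu2
          obtain ⟨k, hk, rfl⟩ := List.getElem_of_mem hu
          rw [List.length_take] at hk
          rw [Finset.mem_filter]
          refine ⟨hu2, ?_⟩
          rw [List.getElem_take]
          rcases Nat.lt_or_ge k j with hkj | hkj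
          · have := sT.getElem_lt_getElem_of_lt (i := k) (j := j) (hi := by omega) (hj := hjT) hkj
            omega
          · have : k = j := by omega
            subst this
            exact key
  omega

theorem tri_union (x : ℕ) : ∀ (n : ℕ) (T S : Finset ℕ), S.card = n →
    (∀ s ∈ S, x < s → (S.filter (fun u => x < u ∧ u ≤ s)).card ≤
      (T.filter (fun t => x ≤ t ∧ t < s)).card) →
    tri T S = tri (T.filter (fun t => t < x)) (S.filter (fun s => s ≤ x)) ∪
        tri (T.filter (fun t => x ≤ t)) (S.filter (fun s => x < s)) := by
  intro n
  induction n with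
  | zero =>
    intro T S h _
    rw [Finset.card_eq_zero] at h
    simp [h, tri_empty_right]
  | succ n ih =>
    intro T S h hd
    have hne : S.Nonempty := Finset.card_pos.1 (by omega)
    obtain ⟨m, hm, hmax⟩ := exists_greatest S hne
    by_cases hmx : m ≤ x
    · have e1 : S.filter (fun s => s ≤ x) = S :=
        Finset.filter_true_of_mem fun s hs => (hmax s hs).trans hmx
      have e2 : S.filter (fun s => x < s) = ∅ :=
        Finset.filter_false_of_mem fun s hs => by have := hmax s hs; omega
      rw [e1, e2, tri_empty_right, Finset.union_empty]
      exact tri_low T S x fun s hs => (hmax s hs).trans hmx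
    · have hxm : x < m := by omega
      have hdm := hd m hm hxm
      have hpos : 0 < (S.filter (fun u => x < u ∧ u ≤ m)).card :=
        Finset.card_pos.2 ⟨m, by simp [hm, hxm]⟩
      obtain ⟨t, ht, htmax⟩ := exists_greatest (T.filter (fun t => x ≤ t ∧ t < m))
        (Finset.card_pos.1 (by omega))
      simp only [Finset.mem_filter] at ht htmax
      obtain ⟨htT, hxt, htm⟩ := ht
      have htmax' : ∀ u ∈ T, u < m → u ≤ t := by
        intro u hu hum
        by_cases hxu : x ≤ u
        · exact htmax u ⟨hu, hxu, hum⟩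
        · omega
      rw [tri_step T S m t hm hmax htT htm htmax',
        tri_step (T.filter (fun t => x ≤ t)) (S.filter (fun s => x < s)) m t
          (by simp [hm, hxm]) (fun s hs => hmax s (Finset.mem_filter.1 hs).1)
          (by simp [htT, hxt]) htm
          (fun u hu hum => htmax' u (Finset.mem_filter.1 hu).1 hum),
        ih (T.filter (fun u => u < t)) (S.erase m)
          (by rw [Finset.card_erase_of_mem hm]; omega) ?_]
      · have e1 : (T.filter (fun u => u < t)).filter (fun t => t < x)
            = T.filter (fun t => t < x) := by
          ext u; simp only [Finset.mem_filter]
          constructor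
          · rintro ⟨⟨a, _⟩, b⟩; exact ⟨a, b⟩
          · rintro ⟨a, b⟩; exact ⟨⟨a, by omega⟩, b⟩
        have e2 : (S.erase m).filter (fun s => s ≤ x) = S.filter (fun s => s ≤ x) := by
          ext u; simp only [Finset.mem_filter, Finset.mem_erase]
          constructor
          · rintro ⟨⟨_, a⟩, b⟩; exact ⟨a, b⟩
          · rintro ⟨a, b⟩; exact ⟨⟨by omega, a⟩, b⟩
        have e3 : (T.filter (fun u => u < t)).filter (fun t => x ≤ t)
            = (T.filter (fun t => x ≤ t)).filter (fun u => u < t) := Finset.filter_comm _ _ _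
        have e4 : (S.erase m).filter (fun s => x < s) = (S.filter (fun s => x < s)).erase m := by
          ext u; simp only [Finset.mem_filter, Finset.mem_erase]; tauto
        rw [e1, e2, e3, e4, Finset.union_insert]
      · intro s hs hxs
        rw [Finset.mem_erase] at hs
        have hsm := hmax s hs.2
        by_cases hst : s ≤ t
        · calc _ ≤ (S.filter (fun u => x < u ∧ u ≤ s)).card :=
                Finset.card_le_card (Finset.filter_subset_filter _ (Finset.erase_subset _ _))
            _ ≤ _ := hd s hs.2 hxs
            _ ≤ _ := by
                apply Finset.card_le_card
                intro u hu
                simp only [Finset.mem_filter] at hu ⊢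
                exact ⟨⟨hu.1, by omega⟩, hu.2⟩
        · have a1 : ((S.erase m).filter (fun u => x < u ∧ u ≤ s)).card + 1 ≤
              (S.filter (fun u => x < u ∧ u ≤ m)).card := by
            rw [← Finset.card_insert_of_notMem (a := m) (by simp)]
            apply Finset.card_le_card
            intro u hu
            simp only [Finset.mem_insert, Finset.mem_filter, Finset.mem_erase] at hu ⊢
            rcases hu with rfl | ⟨⟨_, b⟩, c, d⟩
            · exact ⟨hm, hxm, le_rfl⟩
            · exact ⟨b, c, by omega⟩
          have a2 : (T.filter (fun t => x ≤ t ∧ t < m)).card ≤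
              ((T.filter (fun u => u < t)).filter (fun t => x ≤ t ∧ t < s)).card + 1 := by
            refine le_trans (Finset.card_le_card ?_) (Finset.card_insert_le t _)
            intro u hu
            simp only [Finset.mem_insert, Finset.mem_filter] at hu ⊢
            have := htmax u hu
            by_cases hut : u = t
            · exact Or.inl hut
            · exact Or.inr ⟨⟨hu.1, by omega⟩, hu.2.1, by omega⟩
          omega

theorem stmt8 (S T : Finset ℕ) (hSpos : ∀ a ∈ S, 0 < a) (hTpos : ∀ a ∈ T, 0 < a)
    (x : ℕ) (hx : 0 < x)
    (hd : Dom (T.filter (fun t => x ≤ t)) (S.filter (fun s => x < s))) :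
    Disjoint (tri (T.filter (fun t => t < x)) (S.filter (fun s => s ≤ x)))
        (tri (T.filter (fun t => x ≤ t)) (S.filter (fun s => x < s))) ∧
    tri T S =
      tri (T.filter (fun t => t < x)) (S.filter (fun s => s ≤ x)) ∪
        tri (T.filter (fun t => x ≤ t)) (S.filter (fun s => x < s)) := by
  constructor
  · rw [Finset.disjoint_left]
    intro a ha hb
    have h1 := tri_subset _ _ _ rfl ha
    have h2 := tri_subset _ _ _ rfl hb
    rw [Finset.mem_filter] at h1 h2
    omega
  · apply tri_union x _ T S rfl
    intro s hs hxs
    have := dom_count _ _ hd s (by simp [hs, hxs])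
    rwa [Finset.filter_filter, Finset.filter_filter] at this
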